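/- Let f ∈ [0,1], let t ∈ [0,1] with t > a for a threshold a ∈ (0,1), and let μ = f·λ + (1−f)·δ_t be the sensor measure. For two independent identical sensors, the probability that the conjunctive reading produces a false negative equals (μ ×ₘ μ) {(x, y) : x ≤ a ∨ y ≤ a} = f·a·(2 − f·a). -/

import Mathlib

open MeasureTheory

/-- A sensor that fails with probability `f` reads above a threshold `a` below the true value `t`
with probability `1 - f * a`. -/
theorem sensor_measure_Ioi {f t a : ℝ} (hf : f ∈ Set.Icc (0:ℝ) 1) (ha : a ∈ Set.Icc (0:ℝ) 1)
    (hta : a < t) :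
    (ENNReal.ofReal f • (volume.restrict (Set.Icc (0:ℝ) 1))
      + ENNReal.ofReal (1 - f) • Measure.dirac t) (Set.Ioi a) = ENNReal.ofReal (1 - f * a) := by
  have h_inter : Set.Ioi a ∩ Set.Icc (0:ℝ) 1 = Set.Ioc a 1 := by
    ext x
    simp only [Set.mem_inter_iff, Set.mem_Ioi, Set.mem_Icc, Set.mem_Ioc]
    exact ⟨fun h => ⟨h.1, h.2.2⟩, fun h => ⟨h.1, ha.1.trans h.1.le, h.2⟩⟩
  have hdirac : Measure.dirac t (Set.Ioi a) = 1 := Measure.dirac_apply_of_mem hta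
  rw [Measure.add_apply, Measure.smul_apply, Measure.smul_apply,
    Measure.restrict_apply measurableSet_Ioi, h_inter, Real.volume_Ioc, hdirac, smul_eq_mul,
    smul_eq_mul, mul_one, ← ENNReal.ofReal_mul hf.1,
    ← ENNReal.ofReal_add (mul_nonneg hf.1 (sub_nonneg.2 ha.2)) (sub_nonneg.2 hf.2)]
  congr 1
  ring

theorem isProbabilityMeasure_sensor {f : ℝ} (t : ℝ) (hf : f ∈ Set.Icc (0:ℝ) 1) :
    IsProbabilityMeasure (ENNReal.ofReal f • (volume.restrict (Set.Icc (0:ℝ) 1))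
      + ENNReal.ofReal (1 - f) • Measure.dirac t) := by
  constructor
  simp [← ENNReal.ofReal_add hf.1 (sub_nonneg.2 hf.2)]

theorem conjunctive_two_sensor_false_negative
    (f t a : ℝ) (hf : f ∈ Set.Icc (0:ℝ) 1) (ht : t ∈ Set.Icc (0:ℝ) 1)
    (ha : a ∈ Set.Ioo (0:ℝ) 1) (hta : a < t)
    (μ : Measure ℝ)
    (hμ : μ = ENNReal.ofReal f • (volume.restrict (Set.Icc (0:ℝ) 1))
            + ENNReal.ofReal (1 - f) • Measure.dirac t) :
    (μ.prod μ) {p : ℝ × ℝ | p.1 ≤ a ∨ p.2 ≤ a}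
      = ENNReal.ofReal (f * a * (2 - f * a)) := by
  have : IsProbabilityMeasure μ := hμ ▸ isProbabilityMeasure_sensor t hf
  have h_compl : {p : ℝ × ℝ | p.1 ≤ a ∨ p.2 ≤ a} = (Set.Ioi a ×ˢ Set.Ioi a)ᶜ := by
    ext p
    simp [or_iff_not_imp_left]
  have h_Ioi : μ (Set.Ioi a) = ENNReal.ofReal (1 - f * a) :=
    hμ ▸ sensor_measure_Ioi hf (Set.Ioo_subset_Icc_self ha) hta
  have h_nonneg : 0 ≤ 1 - f * a := sub_nonneg.2 (mul_le_one₀ hf.2 ha.1.le ha.2.le)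
  rw [h_compl, prob_compl_eq_one_sub (measurableSet_Ioi.prod measurableSet_Ioi),
    Measure.prod_prod, h_Ioi, ← ENNReal.ofReal_mul h_nonneg, ← ENNReal.ofReal_one,
    ← ENNReal.ofReal_sub _ (mul_nonneg h_nonneg h_nonneg)]
  congr 1
  ring
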